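/- Let K be a field of characteristic zero containing all roots of unity, let C be a smooth conic over K with no K-points, and let G be a finite subgroup of Aut_K(C). Then G is trivial, or isomorphic to Z/2Z, or isomorphic to Z/2Z × Z/2Z. -/

import Mathlib

open Polynomial in
theorem aux_sq_one {K : Type*} [Field K] [CharZero K]
    (hroots : ∀ n : ℕ, 0 < n → ∃ ζ : K, IsPrimitiveRoot ζ n)
    (q : QuadraticForm K (Fin 3 → K)) (hq : q.Anisotropic)
    (A : Matrix (Fin 3) (Fin 3) K) (hA : ∀ v, q (A.mulVec v) = q v)
    (n : ℕ) (hn : 0 < n) (hAn : A ^ n = 1) : A ^ 2 = 1 := by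
  classical
  obtain ⟨ζ, hζ⟩ := hroots (2 * n) (by omega)
  obtain ⟨η, hη⟩ := hroots 2 (by omega)
  have h1 := X_pow_sub_one_eq_prod (by omega) hζ
  have h2 := X_pow_sub_one_eq_prod (by omega) hη
  have hsub : nthRootsFinset 2 (1 : K) ⊆ nthRootsFinset (2 * n) (1 : K) := by
    intro x hx
    rw [mem_nthRootsFinset (by omega)] at hx ⊢
    rw [pow_mul, hx, one_pow]
  rw [← Finset.prod_sdiff hsub, ← h2] at h1
  have h3 := congrArg (aeval A) h1
  rw [map_mul] at h3
  simp only [map_sub, map_pow, aeval_X, map_one] at h3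
  rw [pow_mul', hAn, one_pow, sub_self] at h3
  have hu : IsUnit (aeval A (∏ x ∈ nthRootsFinset (2 * n) (1 : K) \ nthRootsFinset 2 (1 : K),
      (X - C x))) := by
    refine Finset.prod_induction (fun x : K => X - C x) (fun p => IsUnit (aeval A p)) ?_ ?_ ?_
    · intro a b ha hb
      rw [map_mul]
      exact ha.mul hb
    · simp
    · intro x hx
      rw [Finset.mem_sdiff, mem_nthRootsFinset (by omega : 0 < 2)] at hx
      rw [← Matrix.mulVec_injective_iff_isUnit]
      rw [← Matrix.coe_mulVecLin, ← LinearMap.ker_eq_bot, LinearMap.ker_eq_bot']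
      intro v hv
      by_contra hv0
      have hqv : q v ≠ 0 := fun h => hv0 (hq v h)
      have hAv : A.mulVec v = x • v := by
        rw [Matrix.mulVecLin_apply, map_sub, aeval_X, aeval_C] at hv
        simp only [Matrix.sub_mulVec, Algebra.algebraMap_eq_smul_one, Matrix.smul_mulVec, Matrix.one_mulVec] at hv
        exact sub_eq_zero.mp hv
      have := hA v
      rw [hAv, QuadraticMap.map_smul, smul_eq_mul] at this
      apply hx.2
      apply mul_right_cancel₀ hqv
      linear_combination this
  exact sub_eq_zero.mp ((hu.mul_right_eq_zero).mp h3.symm)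

theorem aux_trace {K : Type*} [Field K] (A : Matrix (Fin 3) (Fin 3) K)
    (h2 : A ^ 2 = 1) (hd : A.det = 1) (h1 : A ≠ 1) : A.trace = -1 := by
  have e1 : A.adjugate = A := by
    have : A * A.adjugate = 1 := by rw [Matrix.mul_adjugate, hd, one_smul]
    calc A.adjugate = (A ^ 2) * A.adjugate := by rw [h2, one_mul]
      _ = A := by rw [pow_two, mul_assoc, this, mul_one]
  have e2 : A.adjugate = A ^ 2 - A.trace • A + A.adjugate.trace • 1 := by
    rw [Matrix.adjugate_fin_three, pow_two]
    ext i j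
    fin_cases i <;> fin_cases j <;>
      simp [Matrix.trace_fin_three, Matrix.mul_apply, Fin.sum_univ_three] <;> ring
  rw [e1, h2] at e2
  have e3 : (1 + A.trace) • (A - 1) = 0 := by
    have : A - (1 - A.trace • A + A.trace • 1) = 0 := sub_eq_zero.mpr e2
    rw [← this]
    module
  rcases smul_eq_zero.mp e3 with h | h
  · linear_combination h
  · exact absurd (sub_eq_zero.mp h) h1

theorem aux_card {K : Type*} [Field K] [CharZero K] {G : Type*} [Group G] [Fintype G]
    (r : G →* Matrix (Fin 3) (Fin 3) K) (hr : ∀ g, g ≠ 1 → (r g).trace = -1) :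
    Fintype.card G ∣ 4 := by
  classical
  set P := ∑ g, r g with hP
  set N := Fintype.card G with hN
  have hN0 : (N : K) ≠ 0 := by simp [hN]
  have hg : ∀ g, r g * P = P := by
    intro g
    rw [hP, Finset.mul_sum]
    simp_rw [← map_mul]
    exact Fintype.sum_equiv (Equiv.mulLeft g) _ _ (fun _ => rfl)
  have hPP : P * P = (N : K) • P := by
    conv_lhs => rw [hP, Finset.sum_mul]
    rw [← hP]
    simp [hg, ← hN, Nat.cast_smul_eq_nsmul]
  have hidem : IsIdempotentElem ((N : K)⁻¹ • P) := by
    rw [IsIdempotentElem, smul_mul_smul_comm, hPP, smul_smul]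
    congr 1
    field_simp
  have hidem' : IsIdempotentElem (Matrix.toLin' ((N : K)⁻¹ • P)) := by
    rw [IsIdempotentElem, Module.End.mul_eq_comp, ← Matrix.toLin'_mul, hidem]
  have ht := (LinearMap.IsIdempotentElem.isProj_range _ hidem').trace
  rw [Matrix.trace_toLin'_eq, Matrix.trace_smul] at ht
  have htP : P.trace = 4 - N := by
    rw [hP, Matrix.trace_sum, ← Finset.add_sum_erase _ _ (Finset.mem_univ 1),
      Finset.sum_congr rfl (fun g hg => hr g (Finset.ne_of_mem_erase hg))]
    simp [Finset.card_erase_of_mem, ← hN]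
    rw [Nat.cast_sub (by rw [hN]; exact Fintype.card_pos)]
    push_cast; ring
  rw [htP, smul_eq_mul] at ht
  set k := Module.finrank K (LinearMap.range (Matrix.toLin' ((N : K)⁻¹ • P)))
  have : (4 : K) = N * (k + 1) := by
    rw [← ht]; field_simp; ring
  exact ⟨k + 1, by exact_mod_cast this⟩

theorem aux_det {K : Type*} [Field K]
    (q : QuadraticForm K (Fin 3 → K)) (hs : (QuadraticMap.polarBilin q).Nondegenerate)
    (A : Matrix (Fin 3) (Fin 3) K) (c : K) (hA : ∀ v, q (A.mulVec v) = c * q v) :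
    A.det ^ 2 = c ^ 3 := by
  set M := LinearMap.BilinForm.toMatrix' (QuadraticMap.polarBilin q) with hM
  have hMd : M.det ≠ 0 := by
    rw [← LinearMap.BilinForm.nondegenerate_toBilin'_iff_det_ne_zero, hM]
    simpa using hs
  have h : A.transpose * M * A = c • M := by
    rw [hM, LinearMap.BilinForm.mul_toMatrix'_mul, ← map_smul]
    congr 1
    refine LinearMap.ext fun x => LinearMap.ext fun y => ?_
    simp only [Matrix.transpose_transpose, LinearMap.BilinForm.comp_apply, Matrix.toLin'_apply, LinearMap.smul_apply,
      QuadraticMap.polarBilin_apply_apply, QuadraticMap.polar, ← Matrix.mulVec_add, hA, smul_eq_mul]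
    ring
  have := congrArg Matrix.det h
  simp only [Matrix.det_mul, Matrix.det_transpose, Matrix.det_smul, Fintype.card_fin] at this
  apply mul_right_cancel₀ hMd
  linear_combination this

theorem aux_uniq {K : Type*} [Field K]
    (q : QuadraticForm K (Fin 3 → K)) (hq : q.Anisotropic)
    (A B : GL (Fin 3) K) (hA : ∀ v, q (A.val.mulVec v) = q v) (hB : ∀ v, q (B.val.mulVec v) = q v)
    (dA : A.val.det = 1) (dB : B.val.det = 1)
    (h : (QuotientGroup.mk A : GL (Fin 3) K ⧸ Subgroup.center (GL (Fin 3) K)) =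
      QuotientGroup.mk B) : A = B := by
  rw [QuotientGroup.eq, Matrix.GeneralLinearGroup.mem_center_iff_val_mem_range_scalar] at h
  obtain ⟨a, ha⟩ := h
  have hBA : B.val = a • A.val := by
    have : B = A * (A⁻¹ * B) := by group
    rw [this, Units.val_mul, ← ha]
    ext i j; simp [mul_comm]
  have h3 : a ^ 3 = 1 := by
    rw [hBA, Matrix.det_smul, dA] at dB
    simpa using dB
  have h2 : a ^ 2 = 1 := by
    have hv : (fun _ => 1 : Fin 3 → K) ≠ 0 := fun h => one_ne_zero (congrFun h 0)
    have hqv : q (fun _ => 1 : Fin 3 → K) ≠ 0 := fun h => hv (hq _ h)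
    have := hB (fun _ => 1)
    rw [hBA, Matrix.smul_mulVec, QuadraticMap.map_smul, hA, smul_eq_mul] at this
    apply mul_right_cancel₀ hqv
    linear_combination this
  have h1 : a = 1 := by linear_combination h3 - a * h2
  ext1
  rw [hBA, h1, one_smul]

theorem aux_group {G : Type*} [Group G] [Finite G] (h2 : ∀ g : G, g ^ 2 = 1)
    (hc : Nat.card G ∣ 4) :
    Subsingleton G ∨ Nonempty (G ≃* Multiplicative (ZMod 2)) ∨
      Nonempty (G ≃* (Multiplicative (ZMod 2) × Multiplicative (ZMod 2))) := by
  have hle := Nat.le_of_dvd (by norm_num) hc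
  have hpos : 0 < Nat.card G := Nat.card_pos
  have hK : ∀ {H : Type _} [Group H] [Finite H], (∀ g : H, g ^ 2 = 1) → Nat.card H = 4 →
      IsKleinFour H := by
    intro H _ _ h2 h
    refine ⟨h, ?_⟩
    have hd := Monoid.exponent_dvd_of_forall_pow_eq_one h2
    rcases (Nat.dvd_prime Nat.prime_two).mp hd with h1 | h1
    · have := Monoid.exp_eq_one_iff.mp h1
      rw [Nat.card_of_subsingleton (1 : H)] at h
      omega
    · exact h1
  interval_cases h : Nat.card G
  · left
    exact (Nat.card_eq_one_iff_unique.mp h).1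
  · right; left
    have : Fact (Nat.Prime 2) := ⟨Nat.prime_two⟩
    exact ⟨mulEquivOfPrimeCardEq (p := 2) h (by simp)⟩
  · omega
  · right; right
    have := hK h2 h
    have : IsKleinFour (Multiplicative (ZMod 2) × Multiplicative (ZMod 2)) := by
      refine ⟨by simp [Nat.card_prod], ?_⟩
      rw [Monoid.exponent_prod]
      simp
    exact IsKleinFour.nonempty_mulEquiv

theorem conic_without_points_finite_subgroups
    (K : Type*) [Field K] [CharZero K]
    (hroots : ∀ n : ℕ, 0 < n → ∃ ζ : K, IsPrimitiveRoot ζ n)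
    (q : QuadraticForm K (Fin 3 → K))
    (hsmooth : (QuadraticMap.polarBilin q).Nondegenerate)
    (hnopoints : q.Anisotropic)
    (G : Subgroup (GL (Fin 3) K ⧸ Subgroup.center (GL (Fin 3) K)))
    (hGfin : Finite G)
    (hGaut : ∀ g ∈ G, ∃ A : GL (Fin 3) K, QuotientGroup.mk A = g ∧
      ∃ c : Kˣ, ∀ v : Fin 3 → K,
        q ((A : Matrix (Fin 3) (Fin 3) K).mulVec v) = (c : K) * q v) :
    Subsingleton G ∨ Nonempty (G ≃* Multiplicative (ZMod 2)) ∨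
      Nonempty (G ≃* (Multiplicative (ZMod 2) × Multiplicative (ZMod 2))) := by
  have hlift : ∀ g : G, ∃ A : GL (Fin 3) K,
      (QuotientGroup.mk A : GL (Fin 3) K ⧸ Subgroup.center (GL (Fin 3) K)) = g ∧
      A.val.det = 1 ∧ ∀ v, q (A.val.mulVec v) = q v := by
    rintro ⟨g, hg⟩
    obtain ⟨A, hAg, c, hA⟩ := hGaut g hg
    have hd := aux_det q hsmooth A.val c hA
    have hd0 : A.val.det ≠ 0 := A.det.ne_zero
    set s : Kˣ := c * A.det⁻¹ with hs
    have hsv : (s : K) = c / A.val.det := by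
      simp [hs, div_eq_mul_inv]
    have hval : (A * Matrix.GeneralLinearGroup.scalar (Fin 3) s).val = (s : K) • A.val := by
      ext i j; simp [mul_comm]
    refine ⟨A * Matrix.GeneralLinearGroup.scalar (Fin 3) s, ?_, ?_, ?_⟩
    · change _ = g
      rw [← hAg, eq_comm, QuotientGroup.eq, inv_mul_cancel_left,
        Matrix.GeneralLinearGroup.center_eq_range_scalar]
      exact ⟨s, rfl⟩
    · rw [hval, Matrix.det_smul, hsv, Fintype.card_fin]
      field_simp
      exact hd.symm
    · intro v
      rw [hval, Matrix.smul_mulVec, QuadraticMap.map_smul, hA, smul_eq_mul, hsv]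
      field_simp
      rw [hd]
  choose r hr hrd hrq using hlift
  have hmulq : ∀ A B : GL (Fin 3) K, (∀ v, q (A.val.mulVec v) = q v) →
      (∀ v, q (B.val.mulVec v) = q v) → ∀ v, q ((A * B).val.mulVec v) = q v := by
    intro A B hA hB v
    rw [Units.val_mul, ← Matrix.mulVec_mulVec, hA, hB]
  have hrone : r 1 = 1 := by
    apply aux_uniq q hnopoints _ _ (hrq 1) (by simp) (hrd 1) (by simp)
    rw [hr]; rfl
  have hrmul : ∀ g h, r (g * h) = r g * r h := by
    intro g h
    apply aux_uniq q hnopoints _ _ (hrq _) (hmulq _ _ (hrq g) (hrq h)) (hrd _)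
      (by rw [Units.val_mul, Matrix.det_mul, hrd, hrd, one_mul])
    rw [hr, QuotientGroup.mk_mul, hr, hr]; rfl
  let R : G →* GL (Fin 3) K := ⟨⟨r, hrone⟩, hrmul⟩
  have hinj : ∀ g : G, r g = 1 → g = 1 := by
    intro g h
    apply Subtype.ext
    rw [← hr g, h]; rfl
  have hsq : ∀ g : G, (r g).val ^ 2 = 1 := by
    intro g
    refine aux_sq_one hroots q hnopoints _ (hrq g) (Nat.card G) Nat.card_pos ?_
    have : R g ^ Nat.card G = 1 := by rw [← map_pow, pow_card_eq_one', map_one]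
    have h := congrArg Units.val this
    simpa [R] using h
  have := Fintype.ofFinite G
  refine aux_group ?_ ?_
  · intro g
    apply hinj
    have : R (g ^ 2) = 1 := by
      rw [map_pow]; ext1; simpa [R] using hsq g
    exact this
  · rw [Nat.card_eq_fintype_card]
    refine aux_card ((Units.coeHom _).comp R) ?_
    intro g hg
    refine aux_trace _ (hsq g) (hrd g) ?_
    intro h
    exact hg (hinj g (Units.ext h))
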